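/- Let M be an infinite model of T_MSO(Fin) and define r̃_M : ℕ_{>1} → ℕ by letting r̃_M(d) be the unique h with 0 < h ≤ d such that M ⊨ ρ_{d,h}. Then r̃_M is a residue function; in particular r̃_M(p^{j+1}) ≡ r̃_M(p^j) (mod p^j) for every prime p and every j ≥ 1. -/

import Mathlib

open FirstOrder FirstOrder.Language

namespace MSO

/-! ### The language `L_⊗` and its semantics -/

/-- The language `L_⊗`: a constant `⊥`, a unary relation `At`,
and two binary relations: `⊆` (encoded `true`) and `≤ᴱ` (encoded `false`). -/
def Lmso : Language where
  Functions := fun n => match n with | 0 => Unit | _ => Empty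
  Relations := fun n => match n with | 1 => Unit | 2 => Bool | _ => Empty

/-- The constant symbol `⊥`. -/
def botC : Lmso.Constants := Unit.unit
/-- The unary relation symbol `At`. -/
def atR : Lmso.Relations 1 := Unit.unit
/-- The binary relation symbol `⊆`. -/
def subR : Lmso.Relations 2 := true
/-- The binary relation symbol `≤ᴱ`. -/
def exleR : Lmso.Relations 2 := false

/-- The interpretation of `⊥` in an `L_⊗`-structure. -/
def botE (M : Type*) [Lmso.Structure M] : M := Structure.funMap botC ![]
/-- The interpretation of `At` in an `L_⊗`-structure. -/
def atE {M : Type*} [Lmso.Structure M] (a : M) : Prop := Structure.RelMap atR ![a]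
/-- The interpretation of `⊆` in an `L_⊗`-structure. -/
def subE {M : Type*} [Lmso.Structure M] (a b : M) : Prop := Structure.RelMap subR ![a, b]
/-- The interpretation of `≤ᴱ` in an `L_⊗`-structure. -/
def exleE {M : Type*} [Lmso.Structure M] (a b : M) : Prop := Structure.RelMap exleR ![a, b]

/-- The monadic second order version `M̃SO(α)` of a linear order `α`, as an `L_⊗`-structure:
the universe is the powerset of `α`, `⊆` is inclusion, `⊥` is `∅`, `At` holds of singletons,
and `A ≤ᴱ B` iff there are `a ∈ A` and `b ∈ B` with `a < b`. -/
instance msoStructure (α : Type*) [LinearOrder α] : Lmso.Structure (Set α) where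
  funMap := fun {n} f _ => match n, f with
    | 0, _ => (∅ : Set α)
  RelMap := fun {n} r v => match n, r with
    | 1, _ => ∃ a : α, v 0 = {a}
    | 2, true => v 0 ⊆ v 1
    | 2, false => ∃ a ∈ v 0, ∃ b ∈ v 1, a < b

/-- `MSO(n)`, the monadic second order version of the `n`-element linear order. -/
abbrev MSOn (n : ℕ) : Type := Set (Fin n)

/-- The operation `⊗` on `L_⊗`-structures: the universe is the product, `⊆` is componentwise,
`⊥` is the pair of bottoms, `At` holds of the atoms (minimal non-bottom elements) of the
resulting order, and `(A,B) ≤ᴱ (C,D)` iff (`A ≠ ⊥` and `D ≠ ⊥`), or `A ≤ᴱ C`, or `B ≤ᴱ D`. -/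
instance tensorStructure (M N : Type*) [Lmso.Structure M] [Lmso.Structure N] :
    Lmso.Structure (M × N) where
  funMap := fun {n} f _ => match n, f with
    | 0, _ => (botE M, botE N)
  RelMap := fun {n} r v => match n, r with
    | 1, _ => v 0 ≠ (botE M, botE N) ∧
        ∀ q : M × N, subE q.1 (v 0).1 → subE q.2 (v 0).2 →
          q = (botE M, botE N) ∨ q = v 0
    | 2, true => subE (v 0).1 (v 1).1 ∧ subE (v 0).2 (v 1).2
    | 2, false => ((v 0).1 ≠ botE M ∧ (v 1).2 ≠ botE N) ∨
        exleE (v 0).1 (v 1).1 ∨ exleE (v 0).2 (v 1).2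

/-! ### Formulas -/

/-- Bounded `L_⊗`-formulas with no free (outer) variables. -/
abbrev BF (n : ℕ) := Lmso.BoundedFormula Empty n

/-- The `i`-th de Bruijn variable as a term. -/
def tv {n : ℕ} (i : Fin n) : Lmso.Term (Empty ⊕ Fin n) := Term.var (Sum.inr i)
/-- The constant `⊥` as a term. -/
def tb {n : ℕ} : Lmso.Term (Empty ⊕ Fin n) := Constants.term botC

def sub' {n : ℕ} (i j : Fin n) : BF n := subR.boundedFormula₂ (tv i) (tv j)
def exle' {n : ℕ} (i j : Fin n) : BF n := exleR.boundedFormula₂ (tv i) (tv j)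
def at' {n : ℕ} (i : Fin n) : BF n := atR.boundedFormula₁ (tv i)
def eq' {n : ℕ} (i j : Fin n) : BF n := Term.bdEqual (tv i) (tv j)
def isBot' {n : ℕ} (i : Fin n) : BF n := Term.bdEqual (tv i) tb
def botSub' {n : ℕ} (i : Fin n) : BF n := subR.boundedFormula₂ tb (tv i)

/-- Finite conjunction. -/
def bigAnd {n : ℕ} (l : List (BF n)) : BF n := l.foldr (· ⊓ ·) ⊤
/-- Finite disjunction. -/
def bigOr {n : ℕ} (l : List (BF n)) : BF n := l.foldr (· ⊔ ·) ⊥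

/-- `k` is the meet of `i` and `j` (with respect to `⊆`). -/
def isMeet {n : ℕ} (k i j : Fin n) : BF n :=
  sub' k i ⊓ sub' k j ⊓
    ∀' ((sub' (Fin.last n) i.castSucc ⊓ sub' (Fin.last n) j.castSucc) ⟹
      sub' (Fin.last n) k.castSucc)

/-- `k` is the join of `i` and `j` (with respect to `⊆`). -/
def isJoin {n : ℕ} (k i j : Fin n) : BF n :=
  sub' i k ⊓ sub' j k ⊓
    ∀' ((sub' i.castSucc (Fin.last n) ⊓ sub' j.castSucc (Fin.last n)) ⟹
      sub' k.castSucc (Fin.last n))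

/-- The meet of `i` and `j` is `⊥`. -/
def meetIsBot {n : ℕ} (i j : Fin n) : BF n :=
  ∀' ((sub' (Fin.last n) i.castSucc ⊓ sub' (Fin.last n) j.castSucc) ⟹ isBot' (Fin.last n))

/-- The join of `i` and `j` is the top element. -/
def joinIsTop {n : ℕ} (i j : Fin n) : BF n :=
  ∀' ((sub' i.castSucc (Fin.last n) ⊓ sub' j.castSucc (Fin.last n)) ⟹
    ∀' (sub' (Fin.last (n + 1)) ((Fin.last n).castSucc)))

/-- `j` is a (Boolean) complement of `i`. -/
def isComplOf {n : ℕ} (j i : Fin n) : BF n := meetIsBot i j ⊓ joinIsTop i j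

/-- `i` is an atom: non-bottom, and minimal among non-bottom elements. -/
def isAtomDef {n : ℕ} (i : Fin n) : BF n :=
  ∼(isBot' i) ⊓
    ∀' (sub' (Fin.last n) i.castSucc ⟹ (isBot' (Fin.last n) ⊔ eq' (Fin.last n) i.castSucc))

/-! ### The base theory `T_base` -/

def axRefl : Lmso.Sentence := ∀' sub' 0 0
def axAntisymm : Lmso.Sentence := ∀' ∀' ((sub' 0 1 ⊓ sub' 1 0) ⟹ eq' 0 1)
def axTrans : Lmso.Sentence := ∀' ∀' ∀' ((sub' 0 1 ⊓ sub' 1 2) ⟹ sub' 0 2)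
def axBotLe : Lmso.Sentence := ∀' botSub' 0
def axTop : Lmso.Sentence := ∃' ∀' (sub' 1 0)
def axMeet : Lmso.Sentence := ∀' ∀' ∃' (isMeet 2 0 1)
def axJoin : Lmso.Sentence := ∀' ∀' ∃' (isJoin 2 0 1)
def axCompl : Lmso.Sentence := ∀' ∃' (isComplOf 1 0)
def axDistrib : Lmso.Sentence :=
  ∀' ∀' ∀' ∀' ∀' ∀' ∀' ∀'
    ((isMeet 3 0 1 ⊓ isMeet 4 0 2 ⊓ isJoin 5 1 2 ⊓ isMeet 6 0 5 ⊓ isJoin 7 3 4) ⟹ sub' 6 7)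
def axAt : Lmso.Sentence := ∀' (at' 0 ⇔ isAtomDef 0)
def axAtomic : Lmso.Sentence := ∀' (∼(isBot' 0) ⟹ ∃' (at' 1 ⊓ sub' 1 0))
def axIrrefl : Lmso.Sentence := ∀' (at' 0 ⟹ ∼(exle' 0 0))
def axTransAt : Lmso.Sentence :=
  ∀' ∀' ∀' ((at' 0 ⊓ at' 1 ⊓ at' 2 ⊓ exle' 0 1 ⊓ exle' 1 2) ⟹ exle' 0 2)
def axTrich : Lmso.Sentence :=
  ∀' ∀' ((at' 0 ⊓ at' 1) ⟹ (exle' 0 1 ⊔ eq' 0 1 ⊔ exle' 1 0))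
def axExleDef : Lmso.Sentence :=
  ∀' ∀' (exle' 0 1 ⇔ ∃' ∃' (at' 2 ⊓ at' 3 ⊓ sub' 2 0 ⊓ sub' 3 1 ⊓ exle' 2 3))

/-- The comprehension axiom for a formula `η(x; Y₁,…,Yₙ)` (with `x` the last variable):
`∀ Ȳ ∃ X ∀ x (At x → (x ⊆ X ↔ η(x; Ȳ)))`. -/
def compAx {n : ℕ} (η : BF (n + 1)) : Lmso.Sentence :=
  BoundedFormula.alls (∃' ∀' (at' (Fin.last (n + 1)) ⟹
    (sub' (Fin.last (n + 1)) ((Fin.last n).castSucc) ⇔ η.liftAt 1 n)))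

/-- The base theory `T_base`: an atomic Boolean algebra under `⊆` with bottom `⊥`, `At`
holding exactly of the atoms, `≤ᴱ` linearly ordering the atoms and determined by its
restriction to the atoms, together with the comprehension scheme. -/
def Tbase : Lmso.Theory :=
  {axRefl, axAntisymm, axTrans, axBotLe, axTop, axMeet, axJoin, axCompl, axDistrib,
    axAt, axAtomic, axIrrefl, axTransAt, axTrich, axExleDef} ∪
  ⋃ n : ℕ, Set.range (compAx (n := n))

/-! ### The theory `T_MSO(Fin)` -/

/-- `i` is the `≤ᴱ`-least atom. -/
def isLeastAtom {n : ℕ} (i : Fin n) : BF n :=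
  at' i ⊓ ∀' (at' (Fin.last n) ⟹ ∼(exle' (Fin.last n) i.castSucc))

/-- `i` is the `≤ᴱ`-greatest atom. -/
def isGreatestAtom {n : ℕ} (i : Fin n) : BF n :=
  at' i ⊓ ∀' (at' (Fin.last n) ⟹ ∼(exle' i.castSucc (Fin.last n)))

/-- `j` is the immediate `≤ᴱ`-successor of the atom `i`. -/
def isSuccOf {n : ℕ} (j i : Fin n) : BF n :=
  at' i ⊓ at' j ⊓ exle' i j ⊓
    ∀' ((at' (Fin.last n) ⊓ exle' i.castSucc (Fin.last n)) ⟹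
      (eq' (Fin.last n) j.castSucc ⊔ exle' j.castSucc (Fin.last n)))

def axLeastAtom : Lmso.Sentence := (∃' at' 0) ⟹ ∃' isLeastAtom 0
def axGreatestAtom : Lmso.Sentence := (∃' at' 0) ⟹ ∃' isGreatestAtom 0
def axSucc : Lmso.Sentence :=
  ∀' ((at' 0 ⊓ ∃' (at' 1 ⊓ exle' 0 1)) ⟹ ∃' isSuccOf 1 0)
def axPred : Lmso.Sentence :=
  ∀' ((at' 0 ⊓ ∃' (at' 1 ⊓ exle' 1 0)) ⟹ ∃' isSuccOf 0 1)
def axLeastIn : Lmso.Sentence :=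
  ∀' (∼(isBot' 0) ⟹ ∃' (at' 1 ⊓ sub' 1 0 ⊓ ∀' ((at' 2 ⊓ sub' 2 0) ⟹ ∼(exle' 2 1))))

/-- The theory `T_MSO(Fin)`: `T_base` together with axioms saying that the ordering of the
atoms is discrete with endpoints, and every non-bottom element contains a least atom. -/
def TMSOFin : Lmso.Theory :=
  Tbase ∪ {axLeastAtom, axGreatestAtom, axSucc, axPred, axLeastIn}

/-! ### Quantifier rank, unnested formulas, and `≈ₖ` -/

/-- Quantifier rank of a bounded formula. -/
def qr : ∀ {n : ℕ}, BF n → ℕ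
  | _, BoundedFormula.falsum => 0
  | _, BoundedFormula.equal _ _ => 0
  | _, BoundedFormula.rel _ _ => 0
  | _, BoundedFormula.imp f g => max (qr f) (qr g)
  | _, BoundedFormula.all f => qr f + 1

/-- A formula is unnested if every atomic subformula is of one of the forms
`x = y`, `c = y`, or `R x̄` with the `xᵢ`, `y` variables (Hodges). -/
def IsUnnested : ∀ {n : ℕ}, BF n → Prop
  | _, BoundedFormula.falsum => True
  | _, BoundedFormula.equal s t =>
      (∃ i j, s = Term.var i ∧ t = Term.var j) ∨
      (∃ (c : Lmso.Constants) (j : _), s = Constants.term c ∧ t = Term.var j)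
  | _, BoundedFormula.rel _ ts => ∀ i, ∃ j, ts i = Term.var j
  | _, BoundedFormula.imp f g => IsUnnested f ∧ IsUnnested g
  | _, BoundedFormula.all f => IsUnnested f

/-- `M ≈ₖ N` : `M` and `N` satisfy the same unnested `L_⊗`-sentences of quantifier
rank at most `k`. -/
def EquivK (k : ℕ) (M N : Type*) [Lmso.Structure M] [Lmso.Structure N] : Prop :=
  ∀ φ : Lmso.Sentence, IsUnnested φ → qr φ ≤ k → (M ⊨ φ ↔ N ⊨ φ)

/-! ### The sentences `ρ_{d,h}`, `ψ_{>n}`, `ψ_{=n}` -/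

/-- The index (in `Fin d`) of `A_h` among `A₁, …, A_d`, identifying `h = 0` with `h = d`. -/
def aIdx (d h : ℕ) (hd : 0 < d) : Fin d := ⟨(h + d - 1) % d, Nat.mod_lt _ hd⟩

/-- The cyclic successor on the indices `{1, …, d}`. -/
def cyc {d : ℕ} (j : Fin d) : Fin d := ⟨((j : ℕ) + 1) % d, Nat.mod_lt _ j.pos⟩

/-- The sentence `ρ_{d,h}`: there is a partition of the atoms into `d` non-bottom elements
`A₁, …, A_d` such that the least atom is in `A₁`, the immediate successor of an atom lying in
`A_j` lies in `A_{j+1}` (cyclically), and the greatest atom is in `A_h`. -/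
def rho (d h : ℕ) : Lmso.Sentence :=
  if hd : 0 < d then
    BoundedFormula.exs (n := d) (
      -- each `A_i` is non-bottom
      bigAnd ((List.finRange d).map fun i => ∼(isBot' i)) ⊓
      -- every atom lies in some `A_i`
      (∀' (at' (Fin.last d) ⟹
        bigOr ((List.finRange d).map fun i => sub' (Fin.last d) i.castSucc))) ⊓
      -- the `A_i` are pairwise disjoint on atoms
      bigAnd ((List.finRange d).flatMap fun i => (List.finRange d).filterMap fun j =>
        if i.val < j.val then
          some (∀' (at' (Fin.last d) ⟹
            ∼(sub' (Fin.last d) i.castSucc ⊓ sub' (Fin.last d) j.castSucc)))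
        else none) ⊓
      -- the least atom lies in `A₁`
      (∀' (isLeastAtom (Fin.last d) ⟹ sub' (Fin.last d) ((aIdx d 1 hd).castSucc))) ⊓
      -- immediate successors move cyclically through the `A_j`
      bigAnd ((List.finRange d).map fun j =>
        ∀' ∀' ((sub' ((Fin.last d).castSucc) (j.castSucc.castSucc) ⊓
            isSuccOf (Fin.last (d + 1)) ((Fin.last d).castSucc)) ⟹
          sub' (Fin.last (d + 1)) ((cyc j).castSucc.castSucc))) ⊓
      -- the greatest atom lies in `A_h`
      (∀' (isGreatestAtom (Fin.last d) ⟹ sub' (Fin.last d) ((aIdx d h hd).castSucc))))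
  else ⊥

/-- The list of formulas `xᵢ ≠ xⱼ` for `i < j < n`. -/
def distinctPairs (n : ℕ) : List (BF n) :=
  (List.finRange n).flatMap fun i => (List.finRange n).filterMap fun j =>
    if i.val < j.val then some (∼(eq' i j)) else none

/-- `ψ_{>n}` : there exist at least `n + 1` distinct atoms. -/
def psiGt (n : ℕ) : Lmso.Sentence :=
  BoundedFormula.exs (n := n + 1)
    (bigAnd ((List.finRange (n + 1)).map fun i => at' i) ⊓ bigAnd (distinctPairs (n + 1)))

/-- `ψ_{=n}` : there exist exactly `n` distinct atoms. -/
def psiEq (n : ℕ) : Lmso.Sentence :=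
  BoundedFormula.exs (n := n)
    (bigAnd ((List.finRange n).map fun i => at' i) ⊓ bigAnd (distinctPairs n) ⊓
      ∀' (at' (Fin.last n) ⟹ bigOr ((List.finRange n).map fun i => eq' (Fin.last n) i.castSucc)))

/-! ### Residue functions and the theories `T_r̃` -/

/-- A residue function `ℙ × ℕ_{>0} → ℕ` (conditions imposed only at primes `p` and `j ≥ 1`):
`r(p,j) < p^j` and `r(p,j+1) ≡ r(p,j) [MOD p^j]`. -/
def IsResidueFunction (r : ℕ → ℕ → ℕ) : Prop :=
  ∀ p j : ℕ, p.Prime → 1 ≤ j → r p j < p ^ j ∧ r p (j + 1) ≡ r p j [MOD p ^ j]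

/-- A function `ℕ_{>1} → ℕ` is a residue function if it arises from a residue function
`ℙ × ℕ_{>0} → ℕ` as in the paper (conditions imposed only for `d > 1`). -/
def IsResidueFunctionTilde (rt : ℕ → ℕ) : Prop :=
  ∃ r : ℕ → ℕ → ℕ, IsResidueFunction r ∧
    ∀ d : ℕ, 1 < d → rt d < d ∧
      ∀ p j : ℕ, p.Prime → 1 ≤ j → p ^ j ∣ d → rt d ≡ r p j [MOD p ^ j]

/-- The theory `T_r̃ = T_MSO(Fin) ∪ {ψ_{>n} : n ∈ ℕ} ∪ {ρ_{d,r̃(d)} : d > 1}`. -/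
def Trt (rt : ℕ → ℕ) : Lmso.Theory :=
  TMSOFin ∪ Set.range psiGt ∪ {σ : Lmso.Sentence | ∃ d : ℕ, 1 < d ∧ σ = rho d (rt d)}

/-! ### Relativization and the sum of sentences -/

/-- Relativization of a formula to the elements `⊆ v`:
each quantifier `∀ Z (…)` becomes `∀ Z (Z ⊆ v → …)`. -/
def relv : ∀ {n : ℕ}, BF n → Fin n → BF n
  | _, BoundedFormula.falsum, _ => BoundedFormula.falsum
  | _, BoundedFormula.equal s t, _ => BoundedFormula.equal s t
  | _, BoundedFormula.rel r ts, _ => BoundedFormula.rel r ts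
  | _, BoundedFormula.imp f g, v => (relv f v).imp (relv g v)
  | n, BoundedFormula.all f, v =>
      BoundedFormula.all (sub' (Fin.last n) v.castSucc ⟹ relv f v.castSucc)

/-- `i` is downward closed with respect to the `≤ᴱ`-ordering of the atoms. -/
def dwcl' {n : ℕ} (i : Fin n) : BF n :=
  ∀' ∀' ((at' ((Fin.last n).castSucc) ⊓ at' (Fin.last (n + 1)) ⊓
      sub' ((Fin.last n).castSucc) (i.castSucc.castSucc) ⊓
      exle' (Fin.last (n + 1)) ((Fin.last n).castSucc)) ⟹
    sub' (Fin.last (n + 1)) (i.castSucc.castSucc))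

/-- The sentence `φ + ψ` : `∃ X (X downward closed ∧ φ^X ∧ ψ^(Xᶜ))`
(with the complement `Xᶜ` introduced by an existential quantifier). -/
def plusSent (φ ψ : Lmso.Sentence) : Lmso.Sentence :=
  ∃' ∃' (dwcl' (0 : Fin 2) ⊓ isComplOf (1 : Fin 2) (0 : Fin 2) ⊓
    relv (φ.liftAt 2 0) (0 : Fin 2) ⊓ relv (ψ.liftAt 2 0) (1 : Fin 2))

/-! ### `FSpec` and ultimate periodicity -/

/-- `FSpec φ` : the set of `n ∈ ℕ` such that `MSO(n) ⊨ φ`. -/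
def FSpec (φ : Lmso.Sentence) : Set ℕ := {n : ℕ | MSOn n ⊨ φ}

/-- A set of naturals is ultimately periodic. -/
def UltPeriodic (S : Set ℕ) : Prop :=
  ∃ N d : ℕ, 0 < d ∧ ∀ n : ℕ, N < n → (n ∈ S ↔ n + d ∈ S)

/-! ### The language `L_MO = {⊆, <}` -/

/-- The language `L_MO` with two binary relations: `⊆` (encoded `true`) and `<`
(encoded `false`). -/
def Lmo : Language where
  Functions := fun _ => Empty
  Relations := fun n => match n with | 2 => Bool | _ => Empty

/-- The monadic second order version `MSO(α)` of a linear order `α` as an `L_MO`-structure: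
`⊆` is inclusion and `<` is the ordering of `α` on singletons. -/
instance moStructure (α : Type*) [LinearOrder α] : Lmo.Structure (Set α) where
  funMap := fun f _ => f.elim
  RelMap := fun {n} r v => match n, r with
    | 2, true => v 0 ⊆ v 1
    | 2, false => ∃ a b : α, v 0 = {a} ∧ v 1 = {b} ∧ a < b

/-! ### Semantics of the formulas in a structure -/

section Realize

variable {M : Type*} [Lmso.Structure M] {n : ℕ} {v : Empty → M} {xs : Fin n → M}

theorem realize_sub' (i j : Fin n) : (sub' i j).Realize v xs ↔ subE (xs i) (xs j) := by
  simp [sub', subE, tv, BoundedFormula.realize_rel₂]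

theorem realize_exle' (i j : Fin n) : (exle' i j).Realize v xs ↔ exleE (xs i) (xs j) := by
  simp [exle', exleE, tv, BoundedFormula.realize_rel₂]

theorem realize_at' (i : Fin n) : (at' i).Realize v xs ↔ atE (xs i) := by
  simp [at', atE, tv, BoundedFormula.realize_rel₁]

theorem realize_eq' (i j : Fin n) : (eq' i j).Realize v xs ↔ xs i = xs j := by
  simp [eq', tv]

theorem realize_isBot' (i : Fin n) : (isBot' i).Realize v xs ↔ xs i = botE M := by
  simp only [isBot', tv, tb, BoundedFormula.realize_bdEqual, Term.realize_var, Sum.elim_inr,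
    Term.realize_constants]
  rw [← funMap_eq_coe_constants (x := ![])]
  rfl

theorem realize_bigAnd (l : List (BF n)) :
    (bigAnd l).Realize v xs ↔ ∀ φ ∈ l, φ.Realize v xs :=
  BoundedFormula.realize_foldr_inf l v xs

theorem realize_bigOr (l : List (BF n)) :
    (bigOr l).Realize v xs ↔ ∃ φ ∈ l, φ.Realize v xs :=
  BoundedFormula.realize_foldr_sup l v xs

end Realize

section Atoms

variable {M : Type*} [Lmso.Structure M]

/-- `a` is the `≤ᴱ`-least atom. -/
def IsLeastAtom (a : M) : Prop := atE a ∧ ∀ b : M, atE b → ¬ exleE b a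

/-- `a` is the `≤ᴱ`-greatest atom. -/
def IsGreatestAtom (a : M) : Prop := atE a ∧ ∀ b : M, atE b → ¬ exleE a b

/-- `b` is the immediate `≤ᴱ`-successor of the atom `a`. -/
def IsSuccAtom (b a : M) : Prop :=
  ((atE a ∧ atE b) ∧ exleE a b) ∧ ∀ c : M, atE c ∧ exleE a c → c = b ∨ exleE b c

theorem realize_isLeastAtom {n : ℕ} {v : Empty → M} {xs : Fin n → M} (i : Fin n) :
    (isLeastAtom i).Realize v xs ↔ IsLeastAtom (xs i) := by
  simp [isLeastAtom, IsLeastAtom, realize_at', realize_exle']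

theorem realize_isGreatestAtom {n : ℕ} {v : Empty → M} {xs : Fin n → M} (i : Fin n) :
    (isGreatestAtom i).Realize v xs ↔ IsGreatestAtom (xs i) := by
  simp [isGreatestAtom, IsGreatestAtom, realize_at', realize_exle']

theorem realize_isSuccOf {n : ℕ} {v : Empty → M} {xs : Fin n → M} (i j : Fin n) :
    (isSuccOf j i).Realize v xs ↔ IsSuccAtom (xs j) (xs i) := by
  simp [isSuccOf, IsSuccAtom, realize_at', realize_exle', realize_eq']

/-- A cyclic partition of the atoms into `d` classes, with the least atom in the class `0`. -/
structure IsCyclicPartition {d : ℕ} (A : Fin d → M) : Prop where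
  cover : ∀ a : M, atE a → ∃ i, subE a (A i)
  disjoint : ∀ a : M, atE a → ∀ i j, subE a (A i) → subE a (A j) → i = j
  least : ∀ a : M, IsLeastAtom a → ∀ i : Fin d, (i : ℕ) = 0 → subE a (A i)
  succ : ∀ (j : Fin d) (a b : M), subE a (A j) → IsSuccAtom b a → subE b (A (cyc j))

theorem exists_isCyclicPartition_of_rho {d h : ℕ} (hd : 0 < d) (H : M ⊨ rho d h) :
    ∃ A : Fin d → M, IsCyclicPartition A ∧
      ∀ a : M, IsGreatestAtom a → subE a (A (aIdx d h hd)) := by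
  rw [rho, dif_pos hd, Sentence.Realize, BoundedFormula.realize_exs] at H
  obtain ⟨A, hA⟩ := H
  simp only [BoundedFormula.realize_inf, realize_bigAnd, realize_bigOr,
    BoundedFormula.realize_all, BoundedFormula.realize_imp,
    realize_at', realize_sub', realize_isLeastAtom, realize_isGreatestAtom,
    Fin.snoc_last, Fin.snoc_castSucc, List.mem_map, List.mem_finRange, true_and,
    exists_exists_eq_and, List.mem_flatMap, List.mem_filterMap, Option.ite_none_right_eq_some,
    Option.some.injEq] at hA
  obtain ⟨⟨⟨⟨⟨-, hcover⟩, hdisj⟩, hleast⟩, hsucc⟩, hgreat⟩ := hA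
  have hlt : ∀ i j : Fin d, i < j → ∀ a : M, atE a → subE a (A i) → ¬ subE a (A j) := by
    intro i j hij a ha hi hj
    have := hdisj _ ⟨i, j, hij, rfl⟩
    simp only [BoundedFormula.realize_inf, BoundedFormula.realize_all,
      BoundedFormula.realize_imp, BoundedFormula.realize_not, realize_at', realize_sub',
      Fin.snoc_last, Fin.snoc_castSucc] at this
    exact this a ha ⟨hi, hj⟩
  refine ⟨A, ⟨hcover, fun a ha i j hi hj => ?_, fun a ha i hi => ?_, fun j a b ha hb => ?_⟩,
    hgreat⟩
  · rcases lt_trichotomy i j with hij | hij | hij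
    · exact absurd hj (hlt i j hij a ha hi)
    · exact hij
    · exact absurd hi (hlt j i hij a ha hj)
  · have : i = aIdx d 1 hd := Fin.ext (by simp [aIdx, hi])
    exact this ▸ hleast a ha
  · have := hsucc _ ⟨j, rfl⟩ a b
    simp only [BoundedFormula.realize_inf, BoundedFormula.realize_imp, realize_sub',
      realize_isSuccOf, Fin.snoc_last, Fin.snoc_castSucc] at this
    exact this ⟨ha, hb⟩

/-! ### Consequences of `T_MSO(Fin)` -/

theorem exists_comprehension (hM : M ⊨ TMSOFin) {n : ℕ} (η : BF (n + 1)) (Y : Fin n → M) :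
    ∃ X : M, ∀ a : M, atE a →
      (subE a X ↔ η.Realize default (Fin.snoc (α := fun _ => M) Y a)) := by
  have h : M ⊨ compAx η :=
    Theory.realize_sentence_of_mem TMSOFin (Or.inl (Or.inr (Set.mem_iUnion.2 ⟨n, η, rfl⟩)))
  rw [compAx, Sentence.Realize, BoundedFormula.realize_alls] at h
  obtain ⟨X, hX⟩ := BoundedFormula.realize_ex.1 (h Y)
  refine ⟨X, fun a ha => ?_⟩
  have := hX a
  simp only [BoundedFormula.realize_imp, BoundedFormula.realize_iff, realize_at', realize_sub',
    Fin.snoc_last, Fin.snoc_castSucc] at this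
  rw [this ha, BoundedFormula.realize_liftAt_one (Nat.le_succ n)]
  refine iff_of_eq (congrArg _ (funext fun i => ?_))
  refine Fin.lastCases ?_ (fun i => ?_) i
  · simp [Fin.succ_last]
  · simp

theorem not_isBot_of_atom (hM : M ⊨ TMSOFin) {a : M} (ha : atE a) : a ≠ botE M := by
  have h : M ⊨ axAt := Theory.realize_sentence_of_mem TMSOFin (by simp [TMSOFin, Tbase])
  have := BoundedFormula.realize_iff.1 (h a)
  simp only [isAtomDef, realize_at', BoundedFormula.realize_inf, BoundedFormula.realize_not,
    realize_isBot'] at this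
  exact (this.1 ha).1

theorem subE_bot_eq (hM : M ⊨ TMSOFin) {a : M} (ha : subE a (botE M)) : a = botE M := by
  have h₁ : M ⊨ axAntisymm := Theory.realize_sentence_of_mem TMSOFin (by simp [TMSOFin, Tbase])
  have h₂ : M ⊨ axBotLe := Theory.realize_sentence_of_mem TMSOFin (by simp [TMSOFin, Tbase])
  have hb : subE (botE M) a := by
    have := h₂ a
    simp only [botSub', tv, tb, BoundedFormula.realize_rel₂, Term.realize_constants,
      Term.realize_var, Sum.elim_inr] at this
    rw [← funMap_eq_coe_constants (x := ![])] at this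
    exact this
  have := h₁ a (botE M)
  simp only [BoundedFormula.realize_imp, BoundedFormula.realize_inf, realize_sub',
    realize_eq'] at this
  exact this ⟨ha, hb⟩

theorem exists_least_atom_in (hM : M ⊨ TMSOFin) {X : M} (hX : X ≠ botE M) :
    ∃ a : M, atE a ∧ subE a X ∧ ∀ b : M, atE b → subE b X → ¬ exleE b a := by
  have h : M ⊨ axLeastIn := Theory.realize_sentence_of_mem TMSOFin (by simp [TMSOFin])
  have := h X
  simp only [BoundedFormula.realize_imp, BoundedFormula.realize_not, realize_isBot',
    BoundedFormula.realize_ex, BoundedFormula.realize_inf, BoundedFormula.realize_all,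
    realize_at', realize_sub', realize_exle'] at this
  obtain ⟨a, ⟨ha, hs⟩, hl⟩ := this hX
  exact ⟨a, ha, hs, fun b hb hbX => hl b ⟨hb, hbX⟩⟩

theorem exists_pred (hM : M ⊨ TMSOFin) {a b : M} (ha : atE a) (hb : atE b) (hba : exleE b a) :
    ∃ c : M, IsSuccAtom a c := by
  have h : M ⊨ axPred := Theory.realize_sentence_of_mem TMSOFin (by simp [TMSOFin])
  have := h a
  simp only [BoundedFormula.realize_imp, BoundedFormula.realize_ex,
    BoundedFormula.realize_inf, realize_at', realize_exle', realize_isSuccOf] at this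
  exact this ⟨ha, b, hb, hba⟩

theorem exists_greatest_atom (hM : M ⊨ TMSOFin) {a : M} (ha : atE a) :
    ∃ b : M, IsGreatestAtom b := by
  have h : M ⊨ axGreatestAtom := Theory.realize_sentence_of_mem TMSOFin (by simp [TMSOFin])
  have := BoundedFormula.realize_imp.1 h
  simp only [BoundedFormula.realize_ex, realize_at', realize_isGreatestAtom] at this
  exact this ⟨a, ha⟩

theorem exists_atom (hM : M ⊨ TMSOFin) [Nontrivial M] : ∃ a : M, atE a := by
  obtain ⟨X, hX⟩ := exists_ne (botE M)
  obtain ⟨a, ha, -⟩ := exists_least_atom_in hM hX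
  exact ⟨a, ha⟩

/-- If `d ∣ e`, a cyclic partition into `e` classes refines one into `d` classes. -/
theorem IsCyclicPartition.subE_of_dvd (hM : M ⊨ TMSOFin) {d e : ℕ} (hd : 0 < d) (hde : d ∣ e)
    {A : Fin d → M} {B : Fin e → M} (hA : IsCyclicPartition A) (hB : IsCyclicPartition B)
    {a : M} (ha : atE a) {j : Fin e} (hj : subE a (B j)) :
    subE a (A ⟨j % d, Nat.mod_lt _ hd⟩) := by
  let C : Fin e → M := fun j => A ⟨j % d, Nat.mod_lt _ hd⟩
  obtain ⟨X, hX⟩ := exists_comprehension hM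
    (bigOr ((List.finRange e).map fun j =>
      sub' (Fin.last (e + e)) (Fin.castAdd e j).castSucc ⊓
        ∼(sub' (Fin.last (e + e)) (Fin.natAdd e j).castSucc))) (Fin.append B C)
  simp only [realize_bigOr, List.mem_map, List.mem_finRange, true_and, exists_exists_eq_and,
    BoundedFormula.realize_inf, BoundedFormula.realize_not, realize_sub', Fin.snoc_last,
    Fin.snoc_castSucc, Fin.append_left, Fin.append_right] at hX
  by_contra hbad
  have haX : subE a X := (hX a ha).2 ⟨j, hj, hbad⟩
  have hXbot : X ≠ botE M := by
    rintro rfl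
    exact not_isBot_of_atom hM ha (subE_bot_eq hM haX)
  obtain ⟨b, hb, hbX, hmin⟩ := exists_least_atom_in hM hXbot
  obtain ⟨k, hk, hbk⟩ := (hX b hb).1 hbX
  by_cases hl : IsLeastAtom b
  · have hk0 : k = ⟨0, k.pos⟩ := hB.disjoint b hb _ _ hk (hB.least b hl _ rfl)
    exact hbk (hA.least b hl _ (by simp [hk0]))
  · obtain ⟨b', hb', hlt⟩ : ∃ b' : M, atE b' ∧ exleE b' b := by
      simpa [IsLeastAtom, hb] using hl
    obtain ⟨c, hc⟩ := exists_pred hM hb hb' hlt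
    obtain ⟨i, hi⟩ := hB.cover c hc.1.1.1
    have hcA : subE c (C i) := by
      by_contra hci
      exact hmin c hc.1.1.1 ((hX c hc.1.1.1).2 ⟨i, hi, hci⟩) hc.1.2
    have hki : k = cyc i := hB.disjoint b hb _ _ hk (hB.succ i c b hi hc)
    have hbC := hA.succ _ c b hcA hc
    have hidx : cyc (⟨i % d, Nat.mod_lt _ hd⟩ : Fin d) = ⟨k % d, Nat.mod_lt _ hd⟩ := by
      apply Fin.ext
      simp [cyc, hki, Nat.mod_mod_of_dvd _ hde]
    rw [hidx] at hbC
    exact hbk hbC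

/-- The indices of the classes of the greatest atom are compatible along divisibility. -/
theorem modEq_of_rho (hM : M ⊨ TMSOFin) [Nontrivial M] {d e h k : ℕ} (hd : 0 < d) (he : 0 < e)
    (hde : d ∣ e) (hh : 0 < h) (hk : 0 < k) (Hd : M ⊨ rho d h) (He : M ⊨ rho e k) :
    k ≡ h [MOD d] := by
  obtain ⟨A, hA, hAg⟩ := exists_isCyclicPartition_of_rho hd Hd
  obtain ⟨B, hB, hBg⟩ := exists_isCyclicPartition_of_rho he He
  obtain ⟨a, ha⟩ := exists_atom hM
  obtain ⟨g, hg⟩ := exists_greatest_atom hM ha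
  have hidx := hA.disjoint g hg.1 _ _ (hA.subE_of_dvd hM hd hde hB hg.1 (hBg g hg)) (hAg g hg)
  have hmod : k + e - 1 ≡ h + d - 1 [MOD d] := by
    simpa [aIdx, Nat.ModEq, Nat.mod_mod_of_dvd _ hde] using congrArg Fin.val hidx
  have h₁ : k + e ≡ h + d [MOD d] := by
    have := hmod.add_right 1
    rwa [Nat.sub_add_cancel (by omega), Nat.sub_add_cancel (by omega)] at this
  have h₂ : k + e ≡ k [MOD d] := by
    simpa using (Nat.ModEq.refl k).add (Nat.modEq_zero_iff_dvd.2 hde)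
  exact h₂.symm.trans (h₁.trans (by simp [Nat.ModEq]))

end Atoms

theorem statement12 (M : Type) [Lmso.Structure M] (hM : M ⊨ TMSOFin) (hinf : Infinite M)
    (rt : ℕ → ℕ) (hrt : ∀ d : ℕ, 1 < d → (0 < rt d ∧ rt d ≤ d ∧ M ⊨ rho d (rt d))) :
    IsResidueFunctionTilde (fun d => rt d % d) ∧
    ∀ p j : ℕ, p.Prime → 1 ≤ j → rt (p ^ (j + 1)) ≡ rt (p ^ j) [MOD p ^ j] := by
  have key : ∀ d e : ℕ, 1 < d → 1 < e → d ∣ e → rt e ≡ rt d [MOD d] := fun d e hd he hde =>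
    modEq_of_rho hM (by omega) (by omega) hde (hrt d hd).1 (hrt e he).1
      (hrt d hd).2.2 (hrt e he).2.2
  have hpow : ∀ p j : ℕ, p.Prime → 1 ≤ j → 1 < p ^ j := fun p j hp hj =>
    Nat.one_lt_pow (by omega) hp.one_lt
  have hstep : ∀ p j : ℕ, p.Prime → 1 ≤ j → rt (p ^ (j + 1)) ≡ rt (p ^ j) [MOD p ^ j] :=
    fun p j hp hj => key _ _ (hpow p j hp hj) (hpow p (j + 1) hp (by omega))
      (pow_dvd_pow p j.le_succ)
  refine ⟨⟨fun p j => rt (p ^ j) % p ^ j, fun p j hp hj => ⟨Nat.mod_lt _ (pow_pos hp.pos j), ?_⟩,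
    fun d hd => ⟨Nat.mod_lt _ (by omega), fun p j hp hj hdvd => ?_⟩⟩, hstep⟩
  · exact (((Nat.mod_modEq _ _).of_dvd (pow_dvd_pow p j.le_succ)).trans (hstep p j hp hj)).trans
      (Nat.mod_modEq _ _).symm
  · exact (((Nat.mod_modEq _ _).of_dvd hdvd).trans (key _ d (hpow p j hp hj) hd hdvd)).trans
      (Nat.mod_modEq _ _).symm

end MSO
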